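/- arXiv:2407.20386 — 2 statements merged into one kernel-verified Lean document; each statement's English description precedes it below -/
import Mathlib

section
/- Fix α ∈ (0, 1/2). For every y > 0, the function G is differentiable at y with derivative G′(y) = −φ(G(y) + y) / ( φ(G(y) + y) + φ(−G(y)) ); in particular −1 < G′(y) < 0. -/
open MeasureTheory ProbabilityTheory

/-- The standard normal cumulative distribution function. -/
noncomputable def Phi (x : ℝ) : ℝ := (gaussianReal 0 1 (Set.Iic x)).toReal

/-- The standard normal density. -/
noncomputable def phi (x : ℝ) : ℝ := Real.exp (-(x ^ 2) / 2) / Real.sqrt (2 * Real.pi)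

/-- The standard normal density is positive. -/
theorem phi_pos (x : ℝ) : 0 < phi x := by
  unfold phi
  positivity

theorem continuous_phi : Continuous phi := by
  unfold phi
  fun_prop

theorem phi_eq_gaussianPDFReal : phi = gaussianPDFReal 0 1 := by
  ext x
  simp [phi, gaussianPDFReal, div_eq_inv_mul]

theorem Phi_eq_integral (x : ℝ) : Phi x = ∫ t in Set.Iic x, phi t := by
  rw [Phi, gaussianReal_apply_eq_integral _ one_ne_zero, phi_eq_gaussianPDFReal]
  exact ENNReal.toReal_ofReal (integral_nonneg fun _ => gaussianPDFReal_nonneg _ _ _)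

/-- The standard normal density is the strict derivative of the distribution function. -/
theorem hasStrictDerivAt_Phi (x : ℝ) : HasStrictDerivAt Phi (phi x) x := by
  have hint : Integrable phi := phi_eq_gaussianPDFReal ▸ integrable_gaussianPDFReal 0 1
  have hPhi : Phi = fun u => Phi 0 + ∫ t in (0 : ℝ)..u, phi t := by
    ext u
    rw [← intervalIntegral.integral_Iic_sub_Iic hint.integrableOn hint.integrableOn,
      ← Phi_eq_integral, ← Phi_eq_integral]
    ring
  rw [hPhi]
  exact (intervalIntegral.integral_hasStrictDerivAt_right
    (continuous_phi.intervalIntegrable _ _)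
    continuous_phi.stronglyMeasurable.stronglyMeasurableAtFilter
    continuous_phi.continuousAt).const_add _

theorem strictMono_Phi : StrictMono Phi :=
  strictMono_of_hasDerivAt_pos (fun x => (hasStrictDerivAt_Phi x).hasDerivAt) phi_pos

/-- For each `y`, the probability that a standard normal variable lies in `(-c, c + y]` is
injective in `c`. -/
theorem injective_Phi_add_sub_Phi_neg (y : ℝ) :
    Function.Injective fun c => Phi (c + y) - Phi (-c) := by
  refine StrictMono.injective fun a b hab => ?_
  have h₁ := strictMono_Phi (add_lt_add_left hab y)
  have h₂ := strictMono_Phi (neg_lt_neg hab)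
  linarith

/-- For fixed `α ∈ (0, 1/2)`, the function `G` (assigning to each `y ≥ 0`
the unique `c > 0` with `Φ(c + y) − Φ(−c) = 1 − α`) is differentiable at every `y > 0`
with derivative `G′(y) = −φ(G(y) + y) / (φ(G(y) + y) + φ(−G(y)))`; in particular
`−1 < G′(y) < 0`. -/
theorem critical_value_hasDerivAt
    (α : ℝ) (hα : 0 < α) (hα' : α < 1 / 2)
    (G : ℝ → ℝ)
    (hG : ∀ y : ℝ, 0 ≤ y → 0 < G y ∧ Phi (G y + y) - Phi (-(G y)) = 1 - α)
    (y : ℝ) (hy : 0 < y) :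
    HasDerivAt G (-(phi (G y + y)) / (phi (G y + y) + phi (-(G y)))) y ∧
      -1 < -(phi (G y + y)) / (phi (G y + y) + phi (-(G y))) ∧
      -(phi (G y + y)) / (phi (G y + y) + phi (-(G y))) < 0 := by
  have hp := phi_pos (G y + y)
  have hq := phi_pos (-(G y))
  have hs := add_pos hp hq
  refine ⟨?_, (lt_div_iff₀ hs).2 (by linarith), div_neg_of_neg_of_pos (neg_neg_of_pos hp) hs⟩
  have hF : HasStrictFDerivAt (fun v : ℝ × ℝ => Phi (v.2 + v.1) - Phi (-v.2))
      (phi (G y + y) • (.snd ℝ ℝ ℝ + .fst ℝ ℝ ℝ) - phi (-(G y)) • -.snd ℝ ℝ ℝ) (y, G y) :=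
    ((hasStrictDerivAt_Phi (G y + y)).comp_hasStrictFDerivAt (f := fun v : ℝ × ℝ => v.2 + v.1)
      (y, G y) (hasStrictFDerivAt_snd.fun_add hasStrictFDerivAt_fst)).fun_sub
    ((hasStrictDerivAt_Phi (-(G y))).comp_hasStrictFDerivAt (f := fun v : ℝ × ℝ => -v.2)
      (y, G y) hasStrictFDerivAt_snd.fun_neg)
  have hinv : ((phi (G y + y) • (.snd ℝ ℝ ℝ + .fst ℝ ℝ ℝ) - phi (-(G y)) • -.snd ℝ ℝ ℝ :
      ℝ × ℝ →L[ℝ] ℝ) ∘L .inr ℝ ℝ ℝ).IsInvertible := by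
    refine ⟨ContinuousLinearEquiv.unitsEquivAut ℝ (Units.mk0 _ hs.ne'), ?_⟩
    ext
    simp
  have hψ := hF.hasStrictFDerivAt_implicitFunctionOfProdDomain hinv
  have heq : G =ᶠ[nhds y] hF.implicitFunctionOfProdDomain hinv := by
    filter_upwards [hF.eventually_apply_implicitFunctionOfProdDomain hinv, lt_mem_nhds hy]
      with x hx hx0
    exact injective_Phi_add_sub_Phi_neg x
      ((hG x hx0.le).2.trans ((hG y hy.le).2.symm.trans hx.symm))
  have hdG : HasDerivAt G (deriv G y) y :=
    (hψ.differentiableAt.congr_of_eventuallyEq heq).hasDerivAt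
  -- The derivative is determined by differentiating the constraint.
  have hconst := ((hasStrictDerivAt_Phi (G y + y)).hasDerivAt.comp (h := fun x => G x + x) y
    (hdG.fun_add (hasDerivAt_id' y))).sub
    ((hasStrictDerivAt_Phi (-(G y))).hasDerivAt.comp (h := fun x => -(G x)) y hdG.fun_neg)
  have hzero := hconst.unique ((hasDerivAt_const y (1 - α)).congr_of_eventuallyEq <| by
    filter_upwards [lt_mem_nhds hy] with x hx using (hG x hx.le).2)
  convert hdG using 1
  rw [div_eq_iff hs.ne']
  linarith
end

section
/- Fix α ∈ (0, 1/2), δ ≥ 0, and σ > 0. Let (c_l, c_u) and (c̃_l, c̃_u) be two pairs of nonnegative real numbers, both satisfying the constraints Φ(c_u + δ/σ) + Φ(c_l) ≥ 2 − α and Φ(c_u) + Φ(c_l + δ/σ) ≥ 2 − α, with c_l + c_u = c̃_l + c̃_u and (c_l, c_u) ≠ (c̃_l, c̃_u). Then the midpoint pair ((c_l + c̃_l)/2, (c_u + c̃_u)/2) satisfies both constraints strictly: Φ((c_u + c̃_u)/2 + δ/σ) + Φ((c_l + c̃_l)/2) > 2 − α and Φ((c_u + c̃_u)/2) + Φ((c_l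 + c̃_l)/2 + δ/σ) > 2 − α. -/
open MeasureTheory ProbabilityTheory

lemma Phi_eq_setIntegral (x : ℝ) : Phi x = ∫ t in Set.Iic x, gaussianPDFReal 0 1 t := by
  rw [Phi, gaussianReal_apply_eq_integral 0 one_ne_zero, ENNReal.toReal_ofReal]
  exact integral_nonneg fun t => gaussianPDFReal_nonneg 0 1 t

lemma continuous_gaussianPDFReal_zero_one : Continuous (gaussianPDFReal 0 1) := by
  unfold gaussianPDFReal
  fun_prop

lemma hasDerivAt_Phi (x : ℝ) : HasDerivAt Phi (gaussianPDFReal 0 1 x) x := by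
  have h_eq : Phi = fun y => Phi 0 + ∫ t in (0 : ℝ)..y, gaussianPDFReal 0 1 t := by
    funext y
    have h := intervalIntegral.integral_Iic_sub_Iic (μ := volume) (a := 0) (b := y)
      (integrable_gaussianPDFReal 0 1).integrableOn (integrable_gaussianPDFReal 0 1).integrableOn
    rw [← h, Phi_eq_setIntegral, Phi_eq_setIntegral]
    ring
  rw [h_eq]
  exact (continuous_gaussianPDFReal_zero_one.integral_hasStrictDerivAt 0 x).hasDerivAt.const_add _

lemma strictAntiOn_gaussianPDFReal_zero_one :
    StrictAntiOn (gaussianPDFReal 0 1) (Set.Ioi 0) := by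
  intro x hx y _ hxy
  simp only [gaussianPDFReal, NNReal.coe_one, mul_one, sub_zero]
  refine mul_lt_mul_of_pos_left (Real.exp_lt_exp.2 ?_) (by positivity)
  have hx' : 0 < x := hx
  nlinarith

lemma strictConcaveOn_Phi : StrictConcaveOn ℝ (Set.Ici 0) Phi := by
  refine StrictAntiOn.strictConcaveOn_of_deriv (convex_Ici 0)
    (fun x _ => (hasDerivAt_Phi x).continuousAt.continuousWithinAt) ?_
  rw [interior_Ici, funext fun x => (hasDerivAt_Phi x).deriv]
  exact strictAntiOn_gaussianPDFReal_zero_one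

lemma Phi_add_Phi_lt_two_mul_Phi_midpoint {x y : ℝ} (hx : 0 ≤ x) (hy : 0 ≤ y) (hxy : x ≠ y) :
    Phi x + Phi y < 2 * Phi ((x + y) / 2) := by
  have h := strictConcaveOn_Phi.2 (Set.mem_Ici.2 hx) (Set.mem_Ici.2 hy) hxy
    (half_pos one_pos) (half_pos one_pos) (add_halves 1)
  simp only [smul_eq_mul] at h
  rw [show 1 / 2 * x + 1 / 2 * y = (x + y) / 2 by ring] at h
  linarith

/-- For `α ∈ (0, 1/2)`, `δ ≥ 0`, `σ > 0`: if two distinct nonnegative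
feasible pairs `(c_l, c_u)` and `(c̃_l, c̃_u)` (satisfying `Φ(c_u + δ/σ) + Φ(c_l) ≥ 2 − α`
and `Φ(c_u) + Φ(c_l + δ/σ) ≥ 2 − α`) have the same sum `c_l + c_u = c̃_l + c̃_u`, then
their midpoint satisfies both constraints strictly. -/
theorem midpoint_strictly_feasible
    (α : ℝ) (hα : 0 < α) (hα' : α < 1 / 2)
    (δ σ : ℝ) (hδ : 0 ≤ δ) (hσ : 0 < σ)
    (cl cu tcl tcu : ℝ)
    (hcl : 0 ≤ cl) (hcu : 0 ≤ cu) (htcl : 0 ≤ tcl) (htcu : 0 ≤ tcu)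
    (hfeas1 : 2 - α ≤ Phi (cu + δ / σ) + Phi cl)
    (hfeas2 : 2 - α ≤ Phi cu + Phi (cl + δ / σ))
    (htfeas1 : 2 - α ≤ Phi (tcu + δ / σ) + Phi tcl)
    (htfeas2 : 2 - α ≤ Phi tcu + Phi (tcl + δ / σ))
    (hsum : cl + cu = tcl + tcu)
    (hne : (cl, cu) ≠ (tcl, tcu)) :
    2 - α < Phi ((cu + tcu) / 2 + δ / σ) + Phi ((cl + tcl) / 2) ∧
      2 - α < Phi ((cu + tcu) / 2) + Phi ((cl + tcl) / 2 + δ / σ) := by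
  have hd : 0 ≤ δ / σ := by positivity
  have hl : cl ≠ tcl := fun h => hne (Prod.ext h (by simp only; linarith))
  have hu : cu ≠ tcu := fun h => hl (by linarith)
  have h1 := Phi_add_Phi_lt_two_mul_Phi_midpoint hcl htcl hl
  have h2 := Phi_add_Phi_lt_two_mul_Phi_midpoint hcu htcu hu
  have h3 := Phi_add_Phi_lt_two_mul_Phi_midpoint (add_nonneg hcl hd) (add_nonneg htcl hd)
    fun h => hl (add_right_cancel h)
  have h4 := Phi_add_Phi_lt_two_mul_Phi_midpoint (add_nonneg hcu hd) (add_nonneg htcu hd)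
    fun h => hu (add_right_cancel h)
  rw [show (cl + δ / σ + (tcl + δ / σ)) / 2 = (cl + tcl) / 2 + δ / σ by ring] at h3
  rw [show (cu + δ / σ + (tcu + δ / σ)) / 2 = (cu + tcu) / 2 + δ / σ by ring] at h4
  constructor <;> linarith
end
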